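/- Let n ≥ 1 and work in U = U_q(A(0,2)^{(4)})^+. If [L̃_{2k−2}, L̃_{2N}] = 0 (plain commutator) for all 2 ≤ k ≤ n and all N ≥ 1, then for all 1 ≤ k ≤ n and all N ≥ 1: [L̃_{2k−1}, L̂_{2N+1}] = [L̂_{2k−1}, L̃_{2N+1}], where both brackets are anticommutators (braiding scalar −1), i.e. L̃_{2k−1}L̂_{2N+1} + L̂_{2N+1}L̃_{2k−1} = L̂_{2k−1}L̃_{2N+1} + L̃_{2N+1}L̂_{2k−1}. -/

import Mathlib

noncomputable section

namespace QAff

abbrev F : Type := FreeAlgebra ℂ (Fin 2)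

def x1 : F := FreeAlgebra.ι ℂ 0
def x2 : F := FreeAlgebra.ι ℂ 1

def θ (q : ℂ) : ℂ := q - q⁻¹

def L1F (q : ℂ) : F := x1 * x2 - q⁻¹ • (x2 * x1)

def X2F (q : ℂ) : F := x1 * L1F q - L1F q * x1

def Y2F (q : ℂ) : F := L1F q * x2 + x2 * L1F q

/-- the quantum Serre relator `[x₁,[x₁,[x₁,x₂]]]` (braided brackets w.r.t. the bicharacter
`χ((a,b),(c,d)) = (-1)^(bd) q^(ac-ad-bc+bd)`). -/
def serre1 (q : ℂ) : F := x1 * X2F q - q • (X2F q * x1)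

/-- the quantum Serre relator `[[[x₁,x₂],x₂],x₂]` (braided brackets). -/
def serre2 (q : ℂ) : F := Y2F q * x2 - q • (x2 * Y2F q)

inductive Rel (q : ℂ) : F → F → Prop
  | one : Rel q (serre1 q) 0
  | two : Rel q (serre2 q) 0

/-- `U = U_q(A(0,2)^{(4)})^+`, the free algebra on `x₁, x₂` modulo the two-sided ideal
generated by the quantum Serre relators. -/
abbrev U (q : ℂ) : Type := RingQuot (Rel q)

def π (q : ℂ) : F →ₐ[ℂ] U q := RingQuot.mkAlgHom ℂ (Rel q)

/-- `L₁ = [X₁,Y₁] = x₁x₂ - q⁻¹ x₂x₁` in `U`. -/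
def L1U (q : ℂ) : U q := π q x1 * π q x2 - q⁻¹ • (π q x2 * π q x1)

/-- real root vectors `X_n`, `n ≥ 1` (`X 0 := 0` is junk):
`X₁ = x₁`, `X_{n+1} = [X_n, L₁] = X_n L₁ - (-1)^(n-1) L₁ X_n`
(the braiding scalar is `χ((n,n-1),(1,1)) = (-1)^(n-1)`). -/
def X (q : ℂ) : ℕ → U q
  | 0 => 0
  | 1 => π q x1
  | (n+2) => X q (n+1) * L1U q - ((-1 : ℂ)^n) • (L1U q * X q (n+1))

/-- real root vectors `Y_n`, `n ≥ 1` (`Y 0 := 0` is junk):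
`Y₁ = x₂`, `Y_{n+1} = [L₁, Y_n] = L₁ Y_n - (-1)^n Y_n L₁`
(the braiding scalar is `χ((1,1),(n-1,n)) = (-1)^n`). -/
def Y (q : ℂ) : ℕ → U q
  | 0 => 0
  | 1 => π q x2
  | (n+2) => L1U q * Y q (n+1) - ((-1 : ℂ)^(n+1)) • (Y q (n+1) * L1U q)

/-- `L₀ = θ⁻¹·1`, and `L_n = [X₁, Y_n] = X₁Y_n - q⁻¹ Y_n X₁` for `n ≥ 1`
(the braiding scalar is `χ((1,0),(n-1,n)) = q⁻¹`). -/
def L (q : ℂ) : ℕ → U q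
  | 0 => (θ q)⁻¹ • 1
  | (n+1) => X q 1 * Y q (n+1) - q⁻¹ • (Y q (n+1) * X q 1)

/-- `L₀′ = θ⁻¹·1`, `L₁′ = L₁`, and
`L_n′ = [X₂, Y_{n-1}] = X₂Y_{n-1} - (-1)^(n-1) q⁻¹ Y_{n-1}X₂` for `n ≥ 2`
(the braiding scalar is `χ((2,1),(n-2,n-1)) = (-1)^(n-1) q⁻¹`). -/
def L' (q : ℂ) : ℕ → U q
  | 0 => (θ q)⁻¹ • 1
  | 1 => L q 1
  | (n+2) => X q 2 * Y q (n+1) - ((-1 : ℂ)^(n+1) * q⁻¹) • (Y q (n+1) * X q 2)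

/-- `M q n` is the element `M_{2n+1}`:  `M₁ = L₁`, `M_{2n+1} = [L₂, M_{2n-1}]`
(a plain commutator, the braiding scalar being `1`). -/
def M (q : ℂ) : ℕ → U q
  | 0 => L q 1
  | (n+1) => L q 2 * M q n - M q n * L q 2

/-- `L̃_n = (L_n + L_n′)/2`, with the convention `L̃_n = 0` for `n < 0`
(note `L̃₀ = θ⁻¹·1`). -/
def Lt (q : ℂ) (n : ℤ) : U q :=
  if 0 ≤ n then ((2 : ℂ)⁻¹) • (L q n.toNat + L' q n.toNat) else 0

/-- `L̂_{n+1} = [L_n, L₁] = L_n L₁ - (-1)^n L₁ L_n`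
(the braiding scalar is `χ((n,n),(1,1)) = (-1)^n`); in particular `L̂₁ = 0`. -/
def Lhat (q : ℂ) : ℕ → U q
  | 0 => 0
  | (n+1) => L q n * L q 1 - ((-1 : ℂ)^n) • (L q 1 * L q n)

/-- the sequence `P₀ = 1`, `P_n = q^n + q^(n-1) + (-1)^(n-1) P_(n-1)`. -/
def P (q : ℂ) : ℕ → ℂ
  | 0 => 1
  | (n+1) => q^(n+1) + q^n + (-1 : ℂ)^n * P q n

/-- the sequence `Q₀ = 1`, `Q_n = q^n - q^(n-1) + (-1)^n Q_(n-1)`. -/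
def Q (q : ℂ) : ℕ → ℂ
  | 0 => 1
  | (n+1) => q^(n+1) - q^n + (-1 : ℂ)^(n+1) * Q q n

/-- `q` is not a root of unity. -/
def NotRootOfUnity (q : ℂ) : Prop := ∀ n : ℕ, n ≠ 0 → q ^ n ≠ 1

end QAff

open QAff

set_option linter.unusedSimpArgs false

namespace QAff

section Abstract
variable {R : Type*} [Ring R] [Algebra ℂ R] {q s : ℂ}

/-- Bracketing `G` with `[X, Y]`, when `G` almost commutes with both `X` and `Y`. -/
theorem bracket_X₁ (hq : q ≠ 0) (hs : s = 1 ∨ s = -1) {X X' Y Y' G E E' l : R}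
    (h1 : X * G - G * X = q • (X' * E) - (s * q⁻¹) • (E * X'))
    (h2 : G * Y + s • (Y * G) = q • (E' * Y') - (s * q⁻¹) • (Y' * E'))
    (h3 : X * E' - E' * X = q • (X' * l) + (s * q⁻¹) • (l * X'))
    (h4 : E * Y - Y * E = q • (l * Y') - q⁻¹ • (Y' * l)) :
    G * (X * Y - q⁻¹ • (Y * X)) + s • ((X * Y - q⁻¹ • (Y * X)) * G)
      - s • (l * (X' * Y' - (s * q⁻¹) • (Y' * X'))) - (X' * Y' - (s * q⁻¹) • (Y' * X')) * l
      = q • (E' * (X * Y' - q⁻¹ • (Y' * X))) - (s * q⁻¹) • ((X * Y' - q⁻¹ • (Y' * X)) * E')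
        - q • ((X' * Y + (s * q⁻¹) • (Y * X')) * E)
        + (s * q⁻¹) • (E * (X' * Y + (s * q⁻¹) • (Y * X'))) := by
  linear_combination (norm := skip) X * h2 - q⁻¹ • (h2 * X) - h1 * Y - (s * q⁻¹) • (Y * h1)
    + q • (h3 * Y') - (s * q⁻¹ ^ 2) • (Y' * h3) - q • (X' * h4) - q⁻¹ ^ 2 • (h4 * X')
  simp only [mul_add, add_mul, mul_sub, sub_mul, smul_add, smul_sub, smul_smul, smul_mul_assoc,
    mul_smul_comm, mul_assoc]
  rcases hs with rfl | rfl <;> match_scalars <;> field_simp <;> ring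

theorem bracket_X₂ (hq : q ≠ 0) (hs : s = 1 ∨ s = -1) {X X' Y Y' G E E' l : R}
    (h1 : X * G + s • (G * X) = q • (X' * E') - q⁻¹ • (E' * X'))
    (h2 : G * Y - Y * G = q • (E * Y') - q⁻¹ • (Y' * E))
    (h3 : X * E - s • (E * X) = q • (X' * l) - q⁻¹ • (l * X'))
    (h4 : E' * Y - s • (Y * E') = q • (l * Y') + (s * q⁻¹) • (Y' * l)) :
    G * (X * Y - (s * q⁻¹) • (Y * X)) + s • ((X * Y - (s * q⁻¹) • (Y * X)) * G)
      - (X' * Y' - q⁻¹ • (Y' * X')) * l - s • (l * (X' * Y' - q⁻¹ • (Y' * X')))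
      = q • ((X' * Y - q⁻¹ • (Y * X')) * E') - (s * q⁻¹) • (E' * (X' * Y - q⁻¹ • (Y * X')))
        - q • (E * (X * Y' + (s * q⁻¹) • (Y' * X)))
        + (s * q⁻¹) • ((X * Y' + (s * q⁻¹) • (Y' * X)) * E) := by
  linear_combination (norm := skip) s • (h1 * Y) - q⁻¹ • (Y * h1) - s • (X * h2)
    - (s * q⁻¹) • (h2 * X) + (s * q) • (X' * h4) - (s * q⁻¹ ^ 2) • (h4 * X')
    - (s * q) • (h3 * Y') - q⁻¹ ^ 2 • (Y' * h3)
  simp only [mul_add, add_mul, mul_sub, sub_mul, smul_add, smul_sub, smul_smul, smul_mul_assoc,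
    mul_smul_comm, mul_assoc]
  rcases hs with rfl | rfl <;> match_scalars <;> field_simp <;> ring

theorem bracket_right_shift {X Y c : R} :
    (X * c - c * X) * Y - s • (Y * (X * c - c * X))
      = X * (c * Y - Y * c) - s • ((c * Y - Y * c) * X)
        + ((X * Y - s • (Y * X)) * c - c * (X * Y - s • (Y * X))) := by
  simp only [mul_add, add_mul, mul_sub, sub_mul, smul_add, smul_sub, smul_smul, smul_mul_assoc,
    mul_smul_comm, mul_assoc]
  match_scalars <;> ring

theorem relation_commutator {s t r : ℂ} {A B Y Y' c : R} (hA : Commute A c) (hB : Commute B c)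
    (h : A * Y - s • (Y * A) = t • (B * Y') + r • (Y' * B)) :
    A * (c * Y - Y * c) - s • ((c * Y - Y * c) * A)
      = t • (B * (c * Y' - Y' * c)) + r • ((c * Y' - Y' * c) * B) := by
  have hA := hA.eq
  have hB := hB.eq
  linear_combination (norm := skip) c * h - h * c + hA * Y - s • (Y * hA)
    - t • (hB * Y') - r • (Y' * hB)
  simp only [mul_add, add_mul, mul_sub, sub_mul, smul_add, smul_sub, smul_smul, smul_mul_assoc,
    mul_smul_comm, mul_assoc]
  match_scalars <;> ring

/-- `q`-commutation of `X` and `X'` relates their brackets with any `Y`. -/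
theorem relation_of_right_qcomm (hq : q ≠ 0) {X X' Y : R} {s : ℂ} (h : X * X' = q • (X' * X))
    (t : ℂ) :
    X * (X' * Y - (s * q⁻¹) • (Y * X')) - t • ((X' * Y - (s * q⁻¹) • (Y * X')) * X)
      = q • (X' * (X * Y - (t * q⁻¹) • (Y * X)))
        - (s * q⁻¹) • ((X * Y - (t * q⁻¹) • (Y * X)) * X') := by
  linear_combination (norm := skip) h * Y - (s * t * q⁻¹^2) • (Y * h)
  simp only [mul_add, add_mul, mul_sub, sub_mul, smul_add, smul_sub, smul_smul, smul_mul_assoc,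
    mul_smul_comm, mul_assoc]
  match_scalars <;> field_simp <;> ring

/-- `q`-commutation of `Y'` and `Y` relates their brackets with any `X`. -/
theorem relation_of_left_qcomm (hq : q ≠ 0) {X Y Y' : R} {s : ℂ} (h : Y' * Y = q • (Y * Y'))
    (t : ℂ) :
    (X * Y' - (t * q⁻¹) • (Y' * X)) * Y - s • (Y * (X * Y' - (t * q⁻¹) • (Y' * X)))
      = q • ((X * Y - (s * q⁻¹) • (Y * X)) * Y')
        + (-(t * q⁻¹)) • (Y' * (X * Y - (s * q⁻¹) • (Y * X))) := by
  linear_combination (norm := skip) X * h - (s * t * q⁻¹^2) • (h * X)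
  simp only [mul_add, add_mul, mul_sub, sub_mul, smul_add, smul_sub, smul_smul, smul_mul_assoc,
    mul_smul_comm, mul_assoc]
  match_scalars <;> field_simp <;> ring

theorem comm_L'₂_L_odd (hq : q ≠ 0) {x X X2 Y Y2 Y3 K L1 L2 L2' L3 : R}
    (hX2 : X2 = X * x - x * X) (hY2 : Y2 = x * Y + Y * x)
    (hL1 : L1 = X * Y - q⁻¹ • (Y * X)) (hL2 : L2 = X * Y2 - q⁻¹ • (Y2 * X))
    (hL2' : L2' = X2 * Y + q⁻¹ • (Y * X2)) (hL3 : L3 = X * Y3 - q⁻¹ • (Y3 * X))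
    (hX : X * K - K * X = q • (X2 * x) + q⁻¹ • (x * X2))
    (hY : K * Y - Y * K = q • (x * Y2) - q⁻¹ • (Y2 * x) - (2 : ℂ) • Y3) :
    K * L1 - L1 * K = q • (L2' * x) - q⁻¹ • (x * L2') + q • (x * L2) - q⁻¹ • (L2 * x)
      - (2 : ℂ) • L3 := by
  subst hL1 hL2 hL2' hL3 hY2 hX2
  linear_combination (norm := skip) X * hY - q⁻¹ • (hY * X) - hX * Y + q⁻¹ • (Y * hX)
  simp only [mul_add, add_mul, mul_sub, sub_mul, smul_add, smul_sub, smul_smul, smul_mul_assoc,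
    mul_smul_comm, mul_assoc]
  match_scalars <;> field_simp <;> ring

theorem comm_L'₂_L₂ (hq : q ≠ 0) {x X X2 Y2 Y3 K L2 L3 L3' : R}
    (hX2 : X2 = X * x - x * X) (hY3 : Y3 = x * Y2 - Y2 * x)
    (hL2 : L2 = X * Y2 - q⁻¹ • (Y2 * X))
    (hL3' : L3' = X2 * Y2 - q⁻¹ • (Y2 * X2)) (hL3 : L3 = X * Y3 - q⁻¹ • (Y3 * X))
    (hX : X * K - K * X = q • (X2 * x) + q⁻¹ • (x * X2))
    (hY : K * Y2 - Y2 * K = q • (x * Y3) + q⁻¹ • (Y3 * x)) :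
    K * L2 - L2 * K = q • (x * L3) + q⁻¹ • (L3 * x) - q • (L3' * x) - q⁻¹ • (x * L3') := by
  subst hL2 hL3 hL3' hY3 hX2
  linear_combination (norm := skip) X * hY - q⁻¹ • (hY * X) - hX * Y2 + q⁻¹ • (Y2 * hX)
  simp only [mul_add, add_mul, mul_sub, sub_mul, smul_add, smul_sub, smul_smul, smul_mul_assoc,
    mul_smul_comm, mul_assoc]
  match_scalars <;> field_simp <;> ring

theorem L'₂_Y₂_rel (hq : q ≠ 0) {x Y Y2 Y3 K L3' : R}
    (hu : 1 - (q + q⁻¹) ≠ 0)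
    (hY2 : Y2 = x * Y + Y * x) (hY3 : Y3 = x * Y2 - Y2 * x)
    (hx : K * x - x * K = (2 : ℂ) • L3' - (q - q⁻¹) • (K * x + x * K + (2 : ℂ) • (x * x * x)))
    (hL3' : L3' * Y + Y * L3' = q • (K * Y2) - q⁻¹ • (Y2 * K))
    (hY : K * Y - Y * K = q • (x * Y2) - q⁻¹ • (Y2 * x) - (2 : ℂ) • Y3) :
    K * Y2 - Y2 * K = q • (x * Y3) + q⁻¹ • (Y3 * x) := by
  subst hY3 hY2
  refine sub_eq_zero.1 ((smul_eq_zero.1 ?_).resolve_left hu)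
  linear_combination (norm := skip) hx * Y + Y * hx + (2 : ℂ) • hL3' + x * hY + hY * x
    - (q - q⁻¹) • (x * hY - hY * x)
  simp only [mul_add, add_mul, mul_sub, sub_mul, smul_add, smul_sub, smul_smul, smul_mul_assoc,
    mul_smul_comm, mul_assoc]
  match_scalars <;> field_simp <;> ring

theorem X₂_L₂_rel (hq : q ≠ 0) {x X X2 X3 L L3' : R}
    (hu : 1 + (q + q⁻¹) ≠ 0)
    (hX2 : X2 = X * x - x * X) (hX3 : X3 = X2 * x + x * X2)
    (hx : L * x - x * L = (2 : ℂ) • L3' - (q - q⁻¹) • (L * x + x * L - (2 : ℂ) • (x * x * x)))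
    (hL3' : X * L3' - L3' * X = q • (X2 * L) - q⁻¹ • (L * X2))
    (hX : X * L - L * X = q • (X2 * x) + q⁻¹ • (x * X2) + (2 : ℂ) • X3) :
    X2 * L - L * X2 = q • (X3 * x) - q⁻¹ • (x * X3) := by
  subst hX3 hX2
  refine sub_eq_zero.1 ((smul_eq_zero.1 ?_).resolve_left hu)
  linear_combination (norm := skip) (hx * X - X * hx) - (2 : ℂ) • hL3' + hX * x - x * hX
    + (q - q⁻¹) • (x * hX + hX * x)
  simp only [mul_add, add_mul, mul_sub, sub_mul, smul_add, smul_sub, smul_smul, smul_mul_assoc,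
    mul_smul_comm, mul_assoc]
  match_scalars <;> field_simp <;> ring

theorem comm_sq_of_rel (hq : q ≠ 0) {x K L2 L3 L3' : R} (hu : q + q⁻¹ ≠ 0)
    (hu' : 1 + (q + q⁻¹) ≠ 0)
    (hL2 : L2 = K + (2 : ℂ) • (x * x))
    (hL3 : L3 = L3' - (K * x - x * K))
    (hx : K * x - x * K = (2 : ℂ) • L3' - (q - q⁻¹) • (K * x + x * K + (2 : ℂ) • (x * x * x)))
    (h : K * L2 - L2 * K = q • (x * L3) + q⁻¹ • (L3 * x) - q • (L3' * x) - q⁻¹ • (x * L3')) :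
    K * (x * x) - (x * x) * K = 0 := by
  subst hL3 hL2
  refine ((smul_eq_zero.1 ?_).resolve_left (mul_ne_zero hu hu'))
  linear_combination (norm := skip) (2 : ℂ) • h - (q - q⁻¹) • (x * hx) + (q - q⁻¹) • (hx * x)
  simp only [mul_add, add_mul, mul_sub, sub_mul, smul_add, smul_sub, smul_smul, smul_mul_assoc,
    mul_smul_comm, mul_assoc]
  match_scalars <;> field_simp <;> ring

theorem Y₃_Y₂_qcomm (hq : q ≠ 0) {x Y Y2 Y3 K : R} (hu : q + q⁻¹ ≠ 0)
    (hY2 : Y2 = x * Y + Y * x) (hY3 : Y3 = x * Y2 - Y2 * x)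
    (h : Y2 * Y = q • (Y * Y2))
    (h1 : K * Y - Y * K = q • (x * Y2) - q⁻¹ • (Y2 * x) - (2 : ℂ) • Y3)
    (h2 : K * Y2 - Y2 * K = q • (x * Y3) + q⁻¹ • (Y3 * x)) :
    Y3 * Y2 = q • (Y2 * Y3) := by
  subst hY3
  refine sub_eq_zero.1 ((smul_eq_zero.1 ?_).resolve_left hu)
  linear_combination (norm := skip) K * h - h * K - h2 * Y - Y2 * h1 + q • (h1 * Y2) + q • (Y * h2)
    - (q - q⁻¹) • (x * x * h + x * h * x) - q⁻¹ • (x * x * h - h * x * x)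
  subst hY2
  simp only [mul_add, add_mul, mul_sub, sub_mul, smul_add, smul_sub, smul_smul, smul_mul_assoc,
    mul_smul_comm, mul_assoc]
  match_scalars <;> field_simp <;> ring

theorem X₂_X₃_qcomm (hq : q ≠ 0) {x X X2 X3 L : R} (hu : q + q⁻¹ ≠ 0)
    (hX2 : X2 = X * x - x * X) (hX3 : X3 = X2 * x + x * X2)
    (h : X * X2 = q • (X2 * X))
    (h1 : X * L - L * X = q • (X2 * x) + q⁻¹ • (x * X2) + (2 : ℂ) • X3)
    (h2 : X2 * L - L * X2 = q • (X3 * x) - q⁻¹ • (x * X3)) :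
    X2 * X3 = q • (X3 * X2) := by
  subst hX3
  refine sub_eq_zero.1 ((smul_eq_zero.1 ?_).resolve_left hu)
  linear_combination (norm := skip) L * h - h * L + h1 * X2 + X * h2 - q • (h2 * X) - q • (X2 * h1)
    + (q - q⁻¹) • (x * h * x + h * x * x) + q⁻¹ • (h * x * x - x * x * h)
  subst hX2
  simp only [mul_add, add_mul, mul_sub, sub_mul, smul_add, smul_sub, smul_smul, smul_mul_assoc,
    mul_smul_comm, mul_assoc]
  match_scalars <;> field_simp <;> ring

theorem right_bracket_twice (hs : s = 1 ∨ s = -1) {X x : R} :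
    (X * x - s • (x * X)) * x - (s * -1) • (x * (X * x - s • (x * X)))
      = X * (x * x) - x * x * X := by
  simp only [mul_add, add_mul, mul_sub, sub_mul, smul_add, smul_sub, smul_smul, smul_mul_assoc,
    mul_smul_comm, mul_assoc]
  rcases hs with rfl | rfl <;> match_scalars <;> ring

theorem left_bracket_twice (hs : s = 1 ∨ s = -1) {Y x : R} :
    x * (x * Y - s • (Y * x)) - (s * -1) • ((x * Y - s • (Y * x)) * x)
      = x * x * Y - Y * (x * x) := by
  simp only [mul_add, add_mul, mul_sub, sub_mul, smul_add, smul_sub, smul_smul, smul_mul_assoc,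
    mul_smul_comm, mul_assoc]
  rcases hs with rfl | rfl <;> match_scalars <;> ring

theorem sub_neg_one_smul (a b : R) : a - (-1 : ℂ) • b = a + b := by
  rw [neg_one_smul, sub_neg_eq_add]

theorem relation_commutator_add {t r v : ℂ} {A B Y Y' Z c : R} (hA : Commute A c)
    (hB : Commute B c) (h : A * Y - Y * A = t • (B * Y') - r • (Y' * B) - v • Z) :
    A * (c * Y - Y * c) - (c * Y - Y * c) * A
      = t • (B * (c * Y' - Y' * c)) - r • ((c * Y' - Y' * c) * B) - v • (c * Z - Z * c) := by
  have hA := hA.eq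
  have hB := hB.eq
  linear_combination (norm := skip) c * h - h * c + hA * Y - Y * hA
    - t • (hB * Y') + r • (Y' * hB)
  simp only [mul_add, add_mul, mul_sub, sub_mul, smul_add, smul_sub, smul_smul, smul_mul_assoc,
    mul_smul_comm, mul_assoc]
  match_scalars <;> ring

/-- the quadratic expression in two pairs `(A', A)`, `(B', B)` of elements whose vanishing is
equivalent to the wanted relations between imaginary root vectors. -/
def quadDefect (s : ℂ) (A' A B' B : R) : R :=
  A' * B - s • (B * A') + s • (A * B') - B' * A

theorem quadDefect_add (hs : s = 1 ∨ s = -1) {G' G M' M l' l N' N E' E T' T B : R}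
    (h1 : G' * M + s • (M * G') - s • (l * N') - N' * l
      = q • (E' * T) - (s * q⁻¹) • (T * E') - q • (T' * E) + (s * q⁻¹) • (E * T'))
    (h2 : G * M' + s • (M' * G) - B * l' - s • (l' * B)
      = q • (T * E') - (s * q⁻¹) • (E' * T) - q • (E * T') + (s * q⁻¹) • (T' * E))
    (hB : B * l' + s • (l' * B) = N * l' + s • (l' * N)) :
    quadDefect (-s) G' G M' M + quadDefect (-s) l' l N' N
      = (q + q⁻¹) • quadDefect s E' E T' T := by
  unfold quadDefect
  linear_combination (norm := skip) h1 - s • h2 - s • hB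
  simp only [smul_add, smul_sub, smul_smul]
  rcases hs with rfl | rfl <;> match_scalars <;> ring

theorem smul_eq_of_recurrence {f : ℕ → R} {h : ℕ} (hq : q ≠ 0) (h0 : f 0 = 0)
    (hf : ∀ i, i + 2 ≤ h → f (i + 2) + f i = (q + q⁻¹) • f (i + 1)) (i : ℕ) (hi : i ≤ h) :
    (q - q⁻¹) • f i = (q ^ i - q⁻¹ ^ i) • f 1 := by
  induction i using Nat.twoStepInduction with
  | zero => simp [h0]
  | one => simp
  | more i ih1 ih2 =>
    have ih1 := ih1 (by omega)
    have ih2 := ih2 (by omega)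
    have e := hf i hi
    have hqq : q * q⁻¹ = 1 := mul_inv_cancel₀ hq
    linear_combination (norm := skip) (q - q⁻¹) • e + (q + q⁻¹) • ih2 - ih1
    match_scalars <;> try ring
    linear_combination (q ^ i - q⁻¹ ^ i) * hqq

theorem eq_zero_of_recurrence {f : ℕ → R} {h : ℕ} (hq : q ≠ 0) (hq2 : q ^ 2 ≠ 1)
    (hqh : q ^ (2 * h) ≠ 1) (h0 : f 0 = 0) (hh : f h = 0)
    (hf : ∀ i, i + 2 ≤ h → f (i + 2) + f i = (q + q⁻¹) • f (i + 1)) (i : ℕ) (hi : i ≤ h) :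
    f i = 0 := by
  have key (n : ℕ) (hn : q ^ (2 * n) ≠ 1) : q ^ n - q⁻¹ ^ n ≠ 0 := by
    intro e
    apply hn
    have : q ^ n * q⁻¹ ^ n = 1 := by rw [← mul_pow, mul_inv_cancel₀ hq, one_pow]
    linear_combination q ^ n * e + this
  have h1 := smul_eq_of_recurrence hq h0 hf h le_rfl
  rw [hh, smul_zero] at h1
  have h2 := smul_eq_of_recurrence hq h0 hf i hi
  rw [(smul_eq_zero.1 h1.symm).resolve_left (key h hqh), smul_zero] at h2
  refine (smul_eq_zero.1 h2).resolve_left ?_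
  simpa using key 1 (by simpa using hq2)

end Abstract

variable {q : ℂ}

theorem L_one_eq (q : ℂ) : L q 1 = L1U q := rfl
theorem L'_one (q : ℂ) : L' q 1 = L q 1 := rfl
theorem L_zero (q : ℂ) : L q 0 = (θ q)⁻¹ • (1 : U q) := rfl
theorem L'_zero (q : ℂ) : L' q 0 = (θ q)⁻¹ • (1 : U q) := rfl

theorem X_succ (q : ℂ) (n : ℕ) :
    X q (n + 2) = X q (n + 1) * L q 1 - ((-1 : ℂ) ^ n) • (L q 1 * X q (n + 1)) := by
  rw [X, L_one_eq]

theorem Y_succ (q : ℂ) (n : ℕ) :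
    Y q (n + 2) = L q 1 * Y q (n + 1) - ((-1 : ℂ) ^ (n + 1)) • (Y q (n + 1) * L q 1) := by
  rw [Y, L_one_eq]

theorem X_two (q : ℂ) : X q 2 = X q 1 * L q 1 - L q 1 * X q 1 :=
  (X_succ q 0).trans (by rw [pow_zero, one_smul])

theorem X_three (q : ℂ) : X q 3 = X q 2 * L q 1 + L q 1 * X q 2 :=
  (X_succ q 1).trans (by rw [pow_one]; exact sub_neg_one_smul _ _)

theorem Y_two (q : ℂ) : Y q 2 = L q 1 * Y q 1 + Y q 1 * L q 1 :=
  (Y_succ q 0).trans (by rw [zero_add, pow_one]; exact sub_neg_one_smul _ _)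

theorem Y_three (q : ℂ) : Y q 3 = L q 1 * Y q 2 - Y q 2 * L q 1 :=
  (Y_succ q 1).trans (by rw [neg_one_sq, one_smul])

theorem L_succ_def (q : ℂ) (n : ℕ) :
    L q (n + 1) = X q 1 * Y q (n + 1) - q⁻¹ • (Y q (n + 1) * X q 1) := by
  rw [L]

theorem L'_succ_def (q : ℂ) (n : ℕ) : L' q (n + 2) =
    X q 2 * Y q (n + 1) - ((-1 : ℂ) ^ (n + 1) * q⁻¹) • (Y q (n + 1) * X q 2) := by
  rw [L']

/-- the element `L₁²`, whose adjoint action raises the index of `X` and `Y` by two. -/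
def csq (q : ℂ) : U q := L q 1 * L q 1

theorem X_add_three (q : ℂ) (n : ℕ) :
    X q (n + 3) = X q (n + 1) * csq q - csq q * X q (n + 1) := by
  rw [csq, X_succ q (n + 1), X_succ q n, pow_succ]
  exact right_bracket_twice (neg_one_pow_eq_or ℂ n)

theorem Y_add_three (q : ℂ) (n : ℕ) :
    Y q (n + 3) = csq q * Y q (n + 1) - Y q (n + 1) * csq q := by
  rw [csq, Y_succ q (n + 1), Y_succ q n, pow_succ _ (n + 1)]
  exact left_bracket_twice (neg_one_pow_eq_or ℂ (n + 1))

theorem L_succ (q : ℂ) (n : ℕ) :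
    L q (n + 1) = L' q (n + 1) + L q 1 * L q n - ((-1 : ℂ) ^ n) • (L q n * L q 1) := by
  cases n with
  | zero => simp [L'_one, L_zero]
  | succ n =>
    rw [L_succ_def q (n + 1), L'_succ_def, L_succ_def q n, X_succ q 0, Y_succ q n]
    simp only [mul_add, add_mul, mul_sub, sub_mul, smul_add, smul_sub, smul_smul, smul_mul_assoc,
      mul_smul_comm, mul_assoc]
    match_scalars <;> ring

theorem serre_X (q : ℂ) : X q 1 * X q 2 = q • (X q 2 * X q 1) := by
  have h := RingQuot.mkAlgHom_rel ℂ (Rel.one (q := q))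
  have h' : π q (serre1 q) = 0 := by rw [π, h, map_zero]
  rw [serre1, X2F, L1F] at h'
  simp only [map_sub, map_mul, map_smul] at h'
  rw [X_succ q 0, L_one_eq, L1U, X]
  simpa [sub_eq_zero] using h'

theorem serre_Y (q : ℂ) : Y q 2 * Y q 1 = q • (Y q 1 * Y q 2) := by
  have h := RingQuot.mkAlgHom_rel ℂ (Rel.two (q := q))
  have h' : π q (serre2 q) = 0 := by rw [π, h, map_zero]
  rw [serre2, Y2F, L1F] at h'
  simp only [map_sub, map_add, map_mul, map_smul] at h'
  rw [Y_two, L_one_eq, L1U, Y]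
  simpa [sub_eq_zero] using h'

theorem X_one_L' (hq0 : q ≠ 0) (hθ : θ q ≠ 0) (n : ℕ) :
    X q 1 * L' q (n + 1) - L' q (n + 1) * X q 1
      = q • (X q 2 * L q n) - ((-1 : ℂ) ^ n * q⁻¹) • (L q n * X q 2) := by
  cases n with
  | zero =>
    have h : q - q⁻¹ ≠ 0 := hθ
    rw [L'_one, L_zero, θ, X_succ q 0]
    simp only [mul_smul_comm, smul_mul_assoc, mul_one, one_mul, smul_smul, smul_sub, pow_zero,
      one_smul, zero_add]
    have h' : (q - q⁻¹) * (q - q⁻¹)⁻¹ = 1 := mul_inv_cancel₀ h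
    match_scalars
    · linear_combination -h'
    · linear_combination h'
  | succ n =>
    have := relation_of_right_qcomm (Y := Y q (n + 1)) (s := (-1) ^ (n + 1)) hq0 (serre_X q) 1
    rw [L'_succ_def, L_succ_def]
    simpa only [one_mul, one_smul] using this

/-- the bracket of `X m` and `Y p` for odd `m`. -/
def bodd (q : ℂ) (m p : ℕ) : U q := X q m * Y q p - q⁻¹ • (Y q p * X q m)

/-- the bracket of `X m` and `Y p` for even `m`. -/
def beven (q : ℂ) (m p : ℕ) : U q := X q m * Y q p - ((-1 : ℂ) ^ p * q⁻¹) • (Y q p * X q m)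

theorem commute_L'_succ {n : ℕ} (h : Commute (L q (n + 1)) (csq q)) (h' : Commute (L q n) (csq q)) :
    Commute (L' q (n + 1)) (csq q) := by
  have hx : Commute (L q 1) (csq q) := (Commute.refl _).mul_right (Commute.refl _)
  have e : L' q (n + 1) = L q (n + 1) - L q 1 * L q n + ((-1 : ℂ) ^ n) • (L q n * L q 1) := by
    rw [L_succ q n]; abel
  rw [e]
  exact ((h.sub_left (hx.mul_left h')).add_left ((h'.mul_left hx).smul_left _))

theorem bodd_eq (k p : ℕ) (h : ∀ i, i + 1 < 2 * k + (p + 1) → Commute (L q i) (csq q)) :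
    bodd q (2 * k + 1) (p + 1) = L q (2 * k + (p + 1)) := by
  induction k generalizing p with
  | zero => rw [bodd, mul_zero, zero_add, zero_add, L_succ_def]
  | succ k ih =>
    have e1 := ih (p + 2) fun i hi => h i (by omega)
    have e2 := ih p fun i hi => h i (by omega)
    have e3 := (h (2 * k + (p + 1)) (by omega)).eq
    have := bracket_right_shift (X := X q (2 * k + 1)) (Y := Y q (p + 1)) (c := csq q) (s := q⁻¹)
    rw [← X_add_three, ← Y_add_three] at this
    change bodd q (2 * k + 3) (p + 1) = bodd q (2 * k + 1) (p + 3) + (bodd q (2 * k + 1) (p + 1) * _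
      - _ * bodd q (2 * k + 1) (p + 1)) at this
    rw [show 2 * (k + 1) + 1 = 2 * k + 3 by ring, this, e2, e3, sub_self, add_zero, e1]
    congr 1; ring

theorem beven_eq (k p : ℕ) (h : ∀ i < 2 * k + (p + 1), Commute (L q i) (csq q)) :
    beven q (2 * k + 2) (p + 1) = L' q (2 * k + (p + 2)) := by
  induction k generalizing p with
  | zero => rw [beven, mul_zero, zero_add, zero_add, L'_succ_def]
  | succ k ih =>
    have e1 := ih (p + 2) fun i hi => h i (by omega)
    have e2 := ih p fun i hi => h i (by omega)
    have e3 := (commute_L'_succ (n := 2 * k + (p + 1)) (h _ (by omega)) (h _ (by omega))).eq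
    have := bracket_right_shift (X := X q (2 * k + 2)) (Y := Y q (p + 1)) (c := csq q)
      (s := (-1) ^ (p + 1) * q⁻¹)
    rw [← X_add_three q (2 * k + 1), ← Y_add_three] at this
    change beven q (2 * k + 4) (p + 1) = (X q (2 * k + 2) * Y q (p + 3)
      - ((-1 : ℂ) ^ (p + 1) * q⁻¹) • (Y q (p + 3) * X q (2 * k + 2)))
      + (beven q (2 * k + 2) (p + 1) * _ - _ * beven q (2 * k + 2) (p + 1)) at this
    have e4 : (-1 : ℂ) ^ (p + 1) = (-1) ^ (p + 3) := by ring
    rw [e4] at this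
    change beven q (2 * k + 4) (p + 1) = beven q (2 * k + 2) (p + 3) + _ at this
    rw [show 2 * (k + 1) + 2 = 2 * k + 4 by ring, this, e2,
      show 2 * k + (p + 2) = 2 * k + (p + 1) + 1 by ring, e3, sub_self, add_zero, e1]
    congr 1; ring

theorem NotRootOfUnity.θ_ne_zero (hq : NotRootOfUnity q) (hq0 : q ≠ 0) : θ q ≠ 0 := by
  intro h
  refine hq 2 two_ne_zero ?_
  rw [θ] at h
  field_simp at h
  linear_combination h

theorem NotRootOfUnity.add_inv_ne_zero (hq : NotRootOfUnity q) (hq0 : q ≠ 0) : q + q⁻¹ ≠ 0 := by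
  intro h
  refine hq 4 four_ne_zero ?_
  field_simp at h
  linear_combination (q ^ 2 - 1) * h

theorem NotRootOfUnity.one_add_ne_zero (hq : NotRootOfUnity q) (hq0 : q ≠ 0) :
    1 + (q + q⁻¹) ≠ 0 := by
  intro h
  refine hq 3 three_ne_zero ?_
  field_simp at h
  linear_combination (q - 1) * h

theorem NotRootOfUnity.one_sub_ne_zero (hq : NotRootOfUnity q) (hq0 : q ≠ 0) :
    1 - (q + q⁻¹) ≠ 0 := by
  intro h
  refine hq 6 (by norm_num) ?_
  field_simp at h
  linear_combination -(q + 1) * (q ^ 3 - 1) * h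

theorem L'_two (q : ℂ) : L' q 2 = X q 2 * Y q 1 + q⁻¹ • (Y q 1 * X q 2) := by
  rw [L'_succ_def]; module

theorem L'_three (q : ℂ) : L' q 3 = X q 2 * Y q 2 - q⁻¹ • (Y q 2 * X q 2) := by
  rw [L'_succ_def]; module

theorem L_two (q : ℂ) : L q 2 = L' q 2 + (2 : ℂ) • (L q 1 * L q 1) := by
  rw [L_succ q 1]; module

theorem L_three (q : ℂ) : L q 3 = L' q 3 - (L' q 2 * L q 1 - L q 1 * L' q 2) := by
  rw [L_succ q 2, L_two]
  simp only [mul_add, add_mul, mul_smul_comm, smul_mul_assoc, mul_assoc]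
  module

theorem X_one_L'_two (hq0 : q ≠ 0) (hq : NotRootOfUnity q) : X q 1 * L' q 2 - L' q 2 * X q 1
    = q • (X q 2 * L q 1) + q⁻¹ • (L q 1 * X q 2) := by
  rw [X_one_L' hq0 (hq.θ_ne_zero hq0) 1]; module

theorem X_one_L'_three (hq0 : q ≠ 0) (hq : NotRootOfUnity q) : X q 1 * L' q 3 - L' q 3 * X q 1
    = q • (X q 2 * L q 2) - q⁻¹ • (L q 2 * X q 2) := by
  rw [X_one_L' hq0 (hq.θ_ne_zero hq0) 2]; module

theorem X_one_L_two (hq0 : q ≠ 0) (hq : NotRootOfUnity q) : X q 1 * L q 2 - L q 2 * X q 1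
    = q • (X q 2 * L q 1) + q⁻¹ • (L q 1 * X q 2) + (2 : ℂ) • X q 3 := by
  rw [← X_one_L'_two hq0 hq, L_two, X_add_three q 0, csq]
  simp only [mul_add, add_mul, mul_smul_comm, smul_mul_assoc]
  module

theorem L'_two_Y_one (hq0 : q ≠ 0) : L' q 2 * Y q 1 - Y q 1 * L' q 2
    = q • (L q 1 * Y q 2) - q⁻¹ • (Y q 2 * L q 1) - (2 : ℂ) • Y q 3 := by
  have := relation_of_left_qcomm (X := X q 1) (s := 1) hq0 (serre_Y q) 1
  simp only [one_mul, one_smul] at this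
  rw [← L_succ_def, ← L_succ_def, L_two] at this
  simp only [mul_add, add_mul, mul_smul_comm, smul_mul_assoc] at this
  rw [Y_add_three q 0, csq]
  linear_combination (norm := module) this

theorem L'_three_Y_one (hq0 : q ≠ 0) : L' q 3 * Y q 1 + Y q 1 * L' q 3
    = q • (L' q 2 * Y q 2) - q⁻¹ • (Y q 2 * L' q 2) := by
  have := relation_of_left_qcomm (X := X q 2) (s := -1) hq0 (serre_Y q) 1
  rw [L'_three]
  have e : L' q 2 = X q 2 * Y q 1 - (-1 * q⁻¹) • (Y q 1 * X q 2) := by rw [L'_two]; module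
  rw [e]
  rw [one_mul] at this
  linear_combination (norm := module) this

theorem L'_two_L_one (hq0 : q ≠ 0) (hq : NotRootOfUnity q) : L' q 2 * L q 1 - L q 1 * L' q 2
    = (2 : ℂ) • L' q 3 - (q - q⁻¹) • (L' q 2 * L q 1 + L q 1 * L' q 2
      + (2 : ℂ) • (L q 1 * L q 1 * L q 1)) := by
  have := comm_L'₂_L_odd hq0 (X_two q) (Y_two q) (L_succ_def q 0) (L_succ_def q 1) (L'_two q)
    (L_succ_def q 2) (X_one_L'_two hq0 hq) (L'_two_Y_one hq0)
  rw [zero_add, L_three, L_two] at this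
  simp only [mul_add, add_mul, mul_smul_comm, smul_mul_assoc, mul_assoc] at this
  simp only [mul_assoc]
  linear_combination (norm := module) -this

theorem L_two_L_one (hq0 : q ≠ 0) (hq : NotRootOfUnity q) : L q 2 * L q 1 - L q 1 * L q 2
    = (2 : ℂ) • L' q 3 - (q - q⁻¹) • (L q 2 * L q 1 + L q 1 * L q 2
      - (2 : ℂ) • (L q 1 * L q 1 * L q 1)) := by
  have := L'_two_L_one hq0 hq
  rw [L_two]
  simp only [mul_add, add_mul, mul_smul_comm, smul_mul_assoc, mul_assoc] at this ⊢
  linear_combination (norm := module) this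

theorem L'_two_Y_two (hq0 : q ≠ 0) (hq : NotRootOfUnity q) : L' q 2 * Y q 2 - Y q 2 * L' q 2
    = q • (L q 1 * Y q 3) + q⁻¹ • (Y q 3 * L q 1) :=
  L'₂_Y₂_rel hq0 (hq.one_sub_ne_zero hq0) (Y_two q) (Y_three q) (L'_two_L_one hq0 hq)
    (L'_three_Y_one hq0) (L'_two_Y_one hq0)

theorem X_two_L_two (hq0 : q ≠ 0) (hq : NotRootOfUnity q) : X q 2 * L q 2 - L q 2 * X q 2
    = q • (X q 3 * L q 1) - q⁻¹ • (L q 1 * X q 3) :=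
  X₂_L₂_rel hq0 (hq.one_add_ne_zero hq0) (X_two q) (X_three q) (L_two_L_one hq0 hq)
    (X_one_L'_three hq0 hq) (X_one_L_two hq0 hq)

theorem commute_L'_two (hq0 : q ≠ 0) (hq : NotRootOfUnity q) : Commute (L' q 2) (csq q) :=
  sub_eq_zero.1 <| comm_sq_of_rel hq0 (hq.add_inv_ne_zero hq0) (hq.one_add_ne_zero hq0) (L_two q)
    (L_three q) (L'_two_L_one hq0 hq) (comm_L'₂_L₂ hq0 (X_two q) (Y_three q) (L_succ_def q 1)
      (L'_three q) (L_succ_def q 2) (X_one_L'_two hq0 hq) (L'_two_Y_two hq0 hq))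

theorem commute_L_two (hq0 : q ≠ 0) (hq : NotRootOfUnity q) : Commute (L q 2) (csq q) := by
  rw [L_two]
  exact (commute_L'_two hq0 hq).add_left ((Commute.refl (csq q)).smul_left _)

theorem Y_three_Y_two (hq0 : q ≠ 0) (hq : NotRootOfUnity q) :
    Y q 3 * Y q 2 = q • (Y q 2 * Y q 3) :=
  Y₃_Y₂_qcomm hq0 (hq.add_inv_ne_zero hq0) (Y_two q) (Y_three q) (serre_Y q) (L'_two_Y_one hq0)
    (L'_two_Y_two hq0 hq)

theorem X_two_X_three (hq0 : q ≠ 0) (hq : NotRootOfUnity q) :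
    X q 2 * X q 3 = q • (X q 3 * X q 2) :=
  X₂_X₃_qcomm hq0 (hq.add_inv_ne_zero hq0) (X_two q) (X_three q) (serre_X q)
    (X_one_L_two hq0 hq) (X_two_L_two hq0 hq)

theorem commute_L_one (q : ℂ) : Commute (L q 1) (csq q) :=
  (Commute.refl _).mul_right (Commute.refl _)

theorem commute_L_zero (q : ℂ) : Commute (L q 0) (csq q) :=
  (Commute.one_left _).smul_left _

theorem commute_L' {n : ℕ} (h : ∀ i ≤ n, Commute (L q i) (csq q)) : Commute (L' q n) (csq q) := by
  cases n with
  | zero => exact commute_L_zero q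
  | succ n => exact commute_L'_succ (h _ le_rfl) (h _ (by omega))

theorem L'_two_Y_odd (hq0 : q ≠ 0) (hq : NotRootOfUnity q) (k : ℕ) :
    L' q 2 * Y q (2 * k + 1) - Y q (2 * k + 1) * L' q 2 = q • (L q 1 * Y q (2 * k + 2))
      - q⁻¹ • (Y q (2 * k + 2) * L q 1) - (2 : ℂ) • Y q (2 * k + 3) := by
  induction k with
  | zero => exact L'_two_Y_one hq0
  | succ k ih =>
    have := relation_commutator_add (commute_L'_two hq0 hq) (commute_L_one q) ih
    rwa [← Y_add_three, ← Y_add_three q (2 * k + 1), ← Y_add_three q (2 * k + 2)] at this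

theorem commute_L_odd (hq0 : q ≠ 0) (hq : NotRootOfUnity q) (k : ℕ)
    (h : ∀ i < 2 * k + 3, Commute (L q i) (csq q)) : Commute (L q (2 * k + 3)) (csq q) := by
  have hY : Y q (2 * k + 2) = L q 1 * Y q (2 * k + 1) + Y q (2 * k + 1) * L q 1 := by
    rw [Y_succ, pow_succ, pow_mul, neg_one_sq, one_pow]; module
  have hL' : L' q (2 * k + 2) = X q 2 * Y q (2 * k + 1) + q⁻¹ • (Y q (2 * k + 1) * X q 2) := by
    rw [L'_succ_def, pow_succ, pow_mul, neg_one_sq, one_pow]; module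
  have e := comm_L'₂_L_odd hq0 (X_two q) hY (L_succ_def q (2 * k)) (L_succ_def q (2 * k + 1)) hL'
    (L_succ_def q (2 * k + 2)) (X_one_L'_two hq0 hq) (L'_two_Y_odd hq0 hq k)
  have e' : L q (2 * k + 3) = (2 : ℂ)⁻¹ • (q • (L' q (2 * k + 2) * L q 1)
      - q⁻¹ • (L q 1 * L' q (2 * k + 2)) + q • (L q 1 * L q (2 * k + 2))
      - q⁻¹ • (L q (2 * k + 2) * L q 1)
      - (L' q 2 * L q (2 * k + 1) - L q (2 * k + 1) * L' q 2)) := by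
    rw [e]; module
  have h1 := commute_L_one q
  have h2 := commute_L'_two hq0 hq
  have h3 : Commute (L' q (2 * k + 2)) (csq q) := commute_L' fun i hi => h i (by omega)
  have h4 := h (2 * k + 2) (by omega)
  have h5 := h (2 * k + 1) (by omega)
  rw [e']
  exact ((((((h3.mul_left h1).smul_left _).sub_left ((h1.mul_left h3).smul_left _)).add_left
    ((h1.mul_left h4).smul_left _)).sub_left ((h4.mul_left h1).smul_left _)).sub_left
    ((h2.mul_left h5).sub_left (h5.mul_left h2))).smul_left _

theorem θ_smul_sub (hθ : θ q ≠ 0) (a : U q) :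
    q • (a * ((θ q)⁻¹ • (1 : U q))) - q⁻¹ • ((θ q)⁻¹ • (1 : U q) * a) = a := by
  have h' : θ q * (θ q)⁻¹ = 1 := mul_inv_cancel₀ hθ
  nth_rw 1 [θ] at h'
  simp only [mul_smul_comm, smul_mul_assoc, mul_one, one_mul]
  match_scalars
  linear_combination h'

theorem X_two_L (hq0 : q ≠ 0) (hq : NotRootOfUnity q) (n : ℕ)
    (h : ∀ i ≤ n + 1, Commute (L q i) (csq q)) :
    X q 2 * L q (n + 1) - ((-1 : ℂ) ^ (n + 1)) • (L q (n + 1) * X q 2)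
      = q • (X q 3 * L' q n) - q⁻¹ • (L' q n * X q 3) := by
  match n with
  | 0 => rw [L'_zero, θ_smul_sub (hq.θ_ne_zero hq0), X_three]; module
  | 1 =>
    rw [L'_one, ← X_two_L_two hq0 hq]; module
  | (n + 2) =>
    have e := bodd_eq 1 n fun i hi => h i (by omega)
    have := relation_of_right_qcomm (Y := Y q (n + 1)) (s := 1) hq0 (X_two_X_three hq0 hq)
      ((-1) ^ (n + 1))
    rw [one_mul, ← L'_succ_def] at this
    change X q 2 * bodd q 3 (n + 1) - ((-1 : ℂ) ^ (n + 1)) • (bodd q 3 (n + 1) * X q 2) = _ at this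
    have e' : bodd q 3 (n + 1) = L q (n + 2 + 1) := by
      rw [show n + 2 + 1 = 2 * 1 + (n + 1) by ring]
      exact e
    rw [e'] at this
    rw [show (-1 : ℂ) ^ (n + 2 + 1) = (-1) ^ (n + 1) by ring]
    exact this

/-- the relation `A Y_p - s Y_p A = q B Y_{p+1} + r Y_{p+1} B`. -/
def YRel (q s r : ℂ) (A B : U q) (p : ℕ) : Prop :=
  A * Y q p - s • (Y q p * A) = q • (B * Y q (p + 1)) + r • (Y q (p + 1) * B)

theorem YRel.add_two_mul {s r : ℂ} {A B : U q} {p : ℕ} (h : YRel q s r A B (p + 1))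
    (hA : Commute A (csq q)) (hB : Commute B (csq q)) (j : ℕ) :
    YRel q s r A B (p + 2 * j + 1) := by
  induction j with
  | zero => exact h
  | succ j ih =>
    have := relation_commutator hA hB ih
    rwa [← Y_add_three, ← Y_add_three] at this

theorem L_Y_even (hq0 : q ≠ 0) (k : ℕ) (h : ∀ i ≤ 2 * k + 2, Commute (L q i) (csq q)) (j : ℕ) :
    YRel q 1 (-q⁻¹) (L q (2 * k + 2)) (L q (2 * k + 1)) (2 * j + 1) := by
  have e1 := bodd_eq k 1 fun i hi => h i (by omega)
  have e2 := bodd_eq k 0 fun i hi => h i (by omega)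
  have := relation_of_left_qcomm (X := X q (2 * k + 1)) (s := 1) hq0 (serre_Y q) 1
  rw [one_mul] at this
  have := YRel.add_two_mul (p := 0) (A := bodd q (2 * k + 1) 2) (B := bodd q (2 * k + 1) 1) this
    (e1 ▸ h _ (by omega)) (e2 ▸ h _ (by omega)) j
  simp only [e1, e2, zero_add] at this
  exact this

theorem L_Y_odd (hq0 : q ≠ 0) (hq : NotRootOfUnity q) (k : ℕ)
    (h : ∀ i ≤ 2 * k + 1, Commute (L q i) (csq q)) (j : ℕ) :
    YRel q 1 (-q⁻¹) (L q (2 * k + 1)) (L q (2 * k)) (2 * j + 2) := by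
  suffices YRel q 1 (-q⁻¹) (L q (2 * k + 1)) (L q (2 * k)) 2 by
    have := YRel.add_two_mul (p := 1) this (h _ (by omega)) (h _ (by omega)) j
    rwa [show 1 + 2 * j + 1 = 2 * j + 2 by ring] at this
  cases k with
  | zero =>
    have := θ_smul_sub (hq.θ_ne_zero hq0) (Y q 3)
    simp only [mul_smul_comm, smul_mul_assoc, mul_one, one_mul] at this
    rw [YRel, mul_zero, zero_add, L_zero]
    simp only [mul_smul_comm, smul_mul_assoc, mul_one, one_mul, Nat.reduceAdd]
    rw [Y_three] at this ⊢
    linear_combination (norm := module) -this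
  | succ k =>
    have e1 := bodd_eq k 2 fun i hi => h i (by omega)
    have e2 := bodd_eq k 1 fun i hi => h i (by omega)
    have := relation_of_left_qcomm (X := X q (2 * k + 1)) (s := 1) hq0 (Y_three_Y_two hq0 hq) 1
    rw [one_mul] at this
    change YRel q 1 (-q⁻¹) (bodd q (2 * k + 1) 3) (bodd q (2 * k + 1) 2) 2 at this
    rwa [e1, e2] at this

theorem L'_Y_odd (hq0 : q ≠ 0) (hq : NotRootOfUnity q) (k : ℕ)
    (h : ∀ i ≤ 2 * k + 1, Commute (L q i) (csq q)) (j : ℕ) :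
    YRel q (-1) (-q⁻¹) (L' q (2 * k + 1)) (L' q (2 * k)) (2 * j + 1) := by
  suffices YRel q (-1) (-q⁻¹) (L' q (2 * k + 1)) (L' q (2 * k)) 1 by
    have := YRel.add_two_mul (p := 0) this (commute_L' h)
      (commute_L' fun i hi => h i (by omega)) j
    rwa [zero_add] at this
  cases k with
  | zero =>
    have := θ_smul_sub (hq.θ_ne_zero hq0) (Y q 2)
    simp only [mul_smul_comm, smul_mul_assoc, mul_one, one_mul] at this
    rw [YRel, mul_zero, zero_add, L'_zero, L'_one]
    simp only [mul_smul_comm, smul_mul_assoc, mul_one, one_mul, Nat.reduceAdd]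
    rw [Y_two] at this ⊢
    linear_combination (norm := module) -this
  | succ k =>
    have e1 := beven_eq k 1 fun i hi => h i (by omega)
    have e2 := beven_eq k 0 fun i hi => h i (by omega)
    have := relation_of_left_qcomm (X := X q (2 * k + 2)) (s := -1) hq0 (serre_Y q) 1
    rw [one_mul] at this
    have e3 : X q (2 * k + 2) * Y q 2 - q⁻¹ • (Y q 2 * X q (2 * k + 2)) = beven q (2 * k + 2) 2 := by
      rw [beven]; module
    have e4 : X q (2 * k + 2) * Y q 1 - (-1 * q⁻¹) • (Y q 1 * X q (2 * k + 2))
        = beven q (2 * k + 2) 1 := by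
      rw [beven]; module
    rw [e3, e4] at this
    change YRel q (-1) (-q⁻¹) (beven q (2 * k + 2) 2) (beven q (2 * k + 2) 1) 1 at this
    rwa [e1, e2] at this

theorem L'_Y_even (hq0 : q ≠ 0) (hq : NotRootOfUnity q) (k : ℕ)
    (h : ∀ i ≤ 2 * k + 2, Commute (L q i) (csq q)) (j : ℕ) :
    YRel q 1 q⁻¹ (L' q (2 * k + 2)) (L' q (2 * k + 1)) (2 * j + 2) := by
  suffices YRel q 1 q⁻¹ (L' q (2 * k + 2)) (L' q (2 * k + 1)) 2 by
    have := YRel.add_two_mul (p := 1) this (commute_L' h)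
      (commute_L' fun i hi => h i (by omega)) j
    rwa [show 1 + 2 * j + 1 = 2 * j + 2 by ring] at this
  cases k with
  | zero =>
    have := L'_two_Y_two hq0 hq
    rw [YRel, one_smul]
    exact this
  | succ k =>
    have e1 := beven_eq k 2 fun i hi => h i (by omega)
    have e2 := beven_eq k 1 fun i hi => h i (by omega)
    have := relation_of_left_qcomm (X := X q (2 * k + 2)) (s := 1) hq0 (Y_three_Y_two hq0 hq) (-1)
    have e3 : X q (2 * k + 2) * Y q 3 - (-1 * q⁻¹) • (Y q 3 * X q (2 * k + 2))
        = beven q (2 * k + 2) 3 := by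
      rw [beven]; module
    have e4 : X q (2 * k + 2) * Y q 2 - (1 * q⁻¹) • (Y q 2 * X q (2 * k + 2))
        = beven q (2 * k + 2) 2 := by
      rw [beven]; module
    rw [e3, e4, neg_one_mul, neg_neg] at this
    change YRel q 1 q⁻¹ (beven q (2 * k + 2) 3) (beven q (2 * k + 2) 2) 2 at this
    rwa [e1, e2] at this

theorem L_Y (hq0 : q ≠ 0) (hq : NotRootOfUnity q) (n p : ℕ) (hnp : Even (n + p))
    (h : ∀ i ≤ n + 1, Commute (L q i) (csq q)) :
    L q (n + 1) * Y q (p + 2) - Y q (p + 2) * L q (n + 1)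
      = q • (L q n * Y q (p + 3)) - q⁻¹ • (Y q (p + 3) * L q n) := by
  suffices YRel q 1 (-q⁻¹) (L q (n + 1)) (L q n) (p + 2) by
    rw [YRel] at this
    linear_combination (norm := module) this
  rcases Nat.even_or_odd' n with ⟨k, rfl | rfl⟩
  · obtain ⟨j, rfl⟩ : ∃ j, p = 2 * j := ⟨p / 2, by have := Nat.even_iff.1 hnp; omega⟩
    exact L_Y_odd hq0 hq k h j
  · obtain ⟨j, rfl⟩ : ∃ j, p = 2 * j + 1 := ⟨p / 2, by have := Nat.even_iff.1 hnp; omega⟩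
    exact L_Y_even hq0 k h (j + 1)

theorem L'_Y (hq0 : q ≠ 0) (hq : NotRootOfUnity q) (n p : ℕ) (hnp : Even (n + p))
    (h : ∀ i ≤ n + 1, Commute (L q i) (csq q)) :
    L' q (n + 1) * Y q (p + 1) - ((-1 : ℂ) ^ (n + 1)) • (Y q (p + 1) * L' q (n + 1))
      = q • (L' q n * Y q (p + 2)) + ((-1 : ℂ) ^ (n + 1) * q⁻¹) • (Y q (p + 2) * L' q n) := by
  rcases Nat.even_or_odd' n with ⟨k, rfl | rfl⟩
  · obtain ⟨j, rfl⟩ : ∃ j, p = 2 * j := ⟨p / 2, by have := Nat.even_iff.1 hnp; omega⟩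
    have := L'_Y_odd hq0 hq k h j
    rw [pow_succ, pow_mul, neg_one_sq, one_pow, one_mul, neg_one_mul]
    exact this
  · obtain ⟨j, rfl⟩ : ∃ j, p = 2 * j + 1 := ⟨p / 2, by have := Nat.even_iff.1 hnp; omega⟩
    have := L'_Y_even hq0 hq k h j
    rw [Even.neg_one_pow ⟨k + 1, by ring⟩, one_mul]
    exact this

/-- the quadratic defect of the imaginary root vectors of indices `a` and `b`. -/
def Φ (q : ℂ) (a b : ℕ) : U q :=
  quadDefect ((-1) ^ a) (L' q a) (L q a) (L' q b) (L q b)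

theorem Φ_recurrence (hq0 : q ≠ 0) (hq : NotRootOfUnity q) (a r : ℕ) (har : Odd (a + r))
    (h : ∀ i < a + r + 3, Commute (L q i) (csq q)) :
    Φ q (a + 2) (r + 3) + Φ q a (r + 5) = (q + q⁻¹) • Φ q (a + 1) (r + 4) := by
  have hθ := hq.θ_ne_zero hq0
  obtain ⟨s, hs⟩ : ∃ s : ℂ, s = (-1) ^ (a + 1) := ⟨_, rfl⟩
  have hs' : s = 1 ∨ s = -1 := hs ▸ neg_one_pow_eq_or ℂ (a + 1)
  have ha : (-1 : ℂ) ^ a = -s := by rw [hs]; ring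
  have ha2 : (-1 : ℂ) ^ (a + 2) = -s := by rw [hs]; ring
  have hr : (-1 : ℂ) ^ r = s := by
    have : (-1 : ℂ) ^ a * (-1) ^ r = -1 := by rw [← pow_add, har.neg_one_pow]
    rw [ha] at this
    rcases hs' with h | h <;> rw [h] at this ⊢
    · linear_combination -this
    · linear_combination this
  have hr2 : (-1 : ℂ) ^ (r + 1 + 1) = s := by rw [← hr]; ring
  have hr3 : (-1 : ℂ) ^ (r + 2 + 1) = -s := by rw [← hr]; ring
  have hr4 : (-1 : ℂ) ^ (r + 3 + 1) = s := by rw [← hr]; ring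
  -- the root vectors of indices `r + 3`, `r + 4`, `r + 5` as brackets
  have e3 : L' q (r + 3) = X q 2 * Y q (r + 2) - (s * q⁻¹) • (Y q (r + 2) * X q 2) := by
    rw [L'_succ_def q (r + 1), hr2]
  have e4 : L' q (r + 4) = X q 2 * Y q (r + 3) + (s * q⁻¹) • (Y q (r + 3) * X q 2) := by
    rw [L'_succ_def q (r + 2), hr3]; module
  have e5 : L' q (r + 5) = X q 2 * Y q (r + 4) - (s * q⁻¹) • (Y q (r + 4) * X q 2) := by
    rw [L'_succ_def q (r + 3), hr4]
  have e6 : L q (r + 4) = X q 3 * Y q (r + 2) - q⁻¹ • (Y q (r + 2) * X q 3) := by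
    have := bodd_eq (q := q) 1 (r + 1) fun i hi => h i (by omega)
    rw [show r + 4 = 2 * 1 + (r + 1 + 1) by ring]
    exact this.symm
  -- relations for the first bracket
  have h1 := X_one_L' hq0 hθ (a + 1)
  have h2 := L'_Y hq0 hq (a + 1) (r + 2) (by grind) fun i hi => h i (by omega)
  have h3 := X_one_L' hq0 hθ a
  have h4 := L_Y hq0 hq a (r + 1) (by grind) fun i hi => h i (by omega)
  rw [← hs] at h1
  rw [ha2] at h2
  rw [ha] at h3
  have c1 := bracket_X₁ hq0 hs' h1 (Y := Y q (r + 3)) (Y' := Y q (r + 4))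
    (by linear_combination (norm := module) h2) (by linear_combination (norm := module) h3) h4
  rw [← L_succ_def q (r + 2), ← L_succ_def q (r + 3), ← e5, ← e4] at c1
  -- relations for the second bracket
  have k1 := X_two_L hq0 hq (a + 1) fun i hi => h i (by omega)
  have k2 := L_Y hq0 hq (a + 1) r (by grind) fun i hi => h i (by omega)
  have k3 := X_two_L hq0 hq a fun i hi => h i (by omega)
  have k4 := L'_Y hq0 hq a (r + 1) (by grind) fun i hi => h i (by omega)
  rw [ha2] at k1
  rw [← hs] at k3 k4
  have c2 := bracket_X₂ hq0 hs' (Y := Y q (r + 2)) (Y' := Y q (r + 3))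
    (by linear_combination (norm := module) k1) k2 k3 k4
  rw [← e3, ← e4, ← e6] at c2
  rw [Φ, Φ, Φ, ha, ha2, ← hs]
  refine quadDefect_add hs' c1 c2 ?_
  cases a with
  | zero =>
    have : s = -1 := by rw [hs]; norm_num
    subst this
    rw [L'_zero]
    simp only [mul_smul_comm, smul_mul_assoc, mul_one, one_mul]
    module
  | succ a =>
    have e7 := bodd_eq (q := q) 1 (r + 2) fun i hi => h i (by omega)
    rw [show 2 * 1 + (r + 2 + 1) = r + 5 by ring] at e7
    rw [← e7]
    rfl

theorem Φ_zero (b : ℕ) : Φ q 0 b = 0 := by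
  rw [Φ, quadDefect, L'_zero, L_zero]
  simp only [mul_smul_comm, smul_mul_assoc, mul_one, one_mul]
  module

theorem Φ_self (a : ℕ) : Φ q a a = 0 := by
  rw [Φ, quadDefect]; module

theorem Φ_one (n : ℕ) : Φ q 1 (2 * n + 1) = csq q * L q (2 * n) - L q (2 * n) * csq q := by
  rw [Φ, quadDefect, L_succ q (2 * n), pow_mul, neg_one_sq, one_pow, L'_one, csq]
  simp only [mul_add, add_mul, mul_sub, sub_mul, mul_smul_comm, smul_mul_assoc, mul_assoc]
  module

theorem Φ_odd_swap {a b : ℕ} (ha : Odd a) (hb : Odd b) : Φ q a b = -Φ q b a := by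
  rw [Φ, Φ, quadDefect, quadDefect, ha.neg_one_pow, hb.neg_one_pow]
  module

theorem Φ_eq_zero_of_le (hq0 : q ≠ 0) (hq : NotRootOfUnity q) {h : ℕ} (hh : 3 ≤ h)
    (hZ : ∀ i, i + 2 < 2 * h → Commute (L q i) (csq q)) {i : ℕ} (hi : i ≤ h) :
    Φ q i (2 * h - i) = 0 := by
  refine eq_zero_of_recurrence (f := fun i => Φ q i (2 * h - i)) (h := h) hq0 (hq 2 two_ne_zero)
    (hq _ (by omega)) (Φ_zero _) ?_ (fun i hi => ?_) i hi
  · change Φ q h (2 * h - h) = 0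
    rw [show 2 * h - h = h by omega]
    exact Φ_self h
  · obtain ⟨r, hr⟩ : ∃ r, 2 * h = i + r + 5 := ⟨2 * h - i - 5, by omega⟩
    have := Φ_recurrence hq0 hq i r (by grind) fun j hj => hZ j (by omega)
    rwa [← show 2 * h - (i + 2) = r + 3 by omega, ← show 2 * h - i = r + 5 by omega,
      ← show 2 * h - (i + 1) = r + 4 by omega] at this

/-- All imaginary root vectors `L_n` commute with `L₁²`. -/
theorem commute_L_csq (hq0 : q ≠ 0) (hq : NotRootOfUnity q) (n : ℕ) :
    Commute (L q n) (csq q) := by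
  induction n using Nat.strong_induction_on with
  | _ n ih =>
    rcases Nat.even_or_odd' n with ⟨k, rfl | rfl⟩
    · match k with
      | 0 => exact commute_L_zero q
      | 1 => exact commute_L_two hq0 hq
      | (k + 2) =>
        have := Φ_eq_zero_of_le hq0 hq (h := k + 3) (by omega) (fun i hi => ih i (by omega))
          (i := 1) (by omega)
        rw [show 2 * (k + 3) - 1 = 2 * (k + 2) + 1 by omega, Φ_one] at this
        exact (sub_eq_zero.1 this).symm
    · match k with
      | 0 => exact commute_L_one q
      | (k + 1) => exact commute_L_odd hq0 hq k ih

theorem Φ_odd_eq_zero (hq0 : q ≠ 0) (hq : NotRootOfUnity q) {a b : ℕ} (ha : Odd a) (hb : Odd b) :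
    Φ q a b = 0 := by
  wlog hab : a ≤ b generalizing a b
  · rw [Φ_odd_swap ha hb, this hb ha (by omega), neg_zero]
  obtain ⟨h, hh⟩ := ha.add_odd hb
  by_cases h3 : 3 ≤ h
  · have := Φ_eq_zero_of_le hq0 hq h3 (fun i _ => commute_L_csq hq0 hq i) (i := a) (by omega)
    rwa [show 2 * h - a = b by omega] at this
  · obtain ⟨k, rfl⟩ := ha
    obtain ⟨l, rfl⟩ := hb
    obtain rfl : k = 0 := by omega
    rw [mul_zero, zero_add, Φ_one, (commute_L_csq hq0 hq (2 * l)).eq, sub_self]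

theorem Lhat_odd (q : ℂ) (n : ℕ) : Lhat q (2 * n + 1) = L' q (2 * n + 1) - L q (2 * n + 1) := by
  rw [L_succ, Lhat, pow_mul, neg_one_sq, one_pow]; module

theorem Lt_natCast (q : ℂ) (n : ℕ) : Lt q n = (2 : ℂ)⁻¹ • (L q n + L' q n) := by
  rw [Lt, if_pos (Int.natCast_nonneg n), Int.toNat_natCast]

end QAff

/-- In `U = U_q(A(0,2)^{(4)})^+`: fix `n ≥ 1`; if `[L̃_{2k-2}, L̃_{2N}] = 0` (plain commutator)
for all `2 ≤ k ≤ n` and all `N ≥ 1`, then for all `1 ≤ k ≤ n` and all `N ≥ 1`,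
`[L̃_{2k-1}, L̂_{2N+1}] = [L̂_{2k-1}, L̃_{2N+1}]`, both brackets being anticommutators. -/
theorem stmt14 (q : ℂ) (hq0 : q ≠ 0) (hq : NotRootOfUnity q) (n : ℕ) (hn : 1 ≤ n)
    (h : ∀ k : ℕ, 2 ≤ k → k ≤ n → ∀ N : ℕ, 1 ≤ N →
      Lt q (2*(k : ℤ) - 2) * Lt q (2*(N : ℤ)) = Lt q (2*(N : ℤ)) * Lt q (2*(k : ℤ) - 2)) :
    ∀ k : ℕ, 1 ≤ k → k ≤ n → ∀ N : ℕ, 1 ≤ N →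
      Lt q (2*(k : ℤ) - 1) * Lhat q (2*N+1) + Lhat q (2*N+1) * Lt q (2*(k : ℤ) - 1)
        = Lhat q (2*k - 1) * Lt q (2*(N : ℤ) + 1) + Lt q (2*(N : ℤ) + 1) * Lhat q (2*k - 1) := by
  intro k hk _ N _
  obtain ⟨k, rfl⟩ : ∃ l, k = l + 1 := ⟨k - 1, by omega⟩
  rw [show (2 * ((k + 1 : ℕ) : ℤ) - 1) = ((2 * k + 1 : ℕ) : ℤ) by push_cast; ring,
    show (2 * (N : ℤ) + 1) = ((2 * N + 1 : ℕ) : ℤ) by push_cast; ring,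
    show 2 * (k + 1) - 1 = 2 * k + 1 by omega, Lt_natCast, Lt_natCast, Lhat_odd, Lhat_odd]
  have h := Φ_odd_eq_zero hq0 hq (odd_two_mul_add_one k) (odd_two_mul_add_one N)
  rw [Φ, quadDefect, (odd_two_mul_add_one k).neg_one_pow] at h
  simp only [mul_add, add_mul, mul_sub, sub_mul, mul_smul_comm, smul_mul_assoc]
  linear_combination (norm := module) -h
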